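/- Let B be a skew brace such that B = Soc_λ(B) for some ordinal λ (B is socle hypercentral) and such that every element of the group (B,∘) has only finitely many conjugates in (B,∘). If B is finitely generated as a skew brace, then B is finitely presented as a skew brace. -/

import Mathlib

universe u v

/-- A skew (left) brace: two group structures `(B,+)` and `(B,∘)` on the same set,
sharing the same identity element `zero` (recall that in any skew brace `0 = 1`),
satisfying the skew left distributive law `a ∘ (b + c) = a ∘ b - a + a ∘ c`. -/
structure SkewBrace (B : Type u) where
  add : B → B → B
  zero : B
  neg : B → B
  mul : B → B → B
  inv : B → B
  add_assoc : ∀ a b c, add (add a b) c = add a (add b c)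
  zero_add : ∀ a, add zero a = a
  add_zero : ∀ a, add a zero = a
  neg_add : ∀ a, add (neg a) a = zero
  add_neg : ∀ a, add a (neg a) = zero
  mul_assoc : ∀ a b c, mul (mul a b) c = mul a (mul b c)
  zero_mul : ∀ a, mul zero a = a
  mul_zero : ∀ a, mul a zero = a
  inv_mul : ∀ a, mul (inv a) a = zero
  mul_inv : ∀ a, mul a (inv a) = zero
  compat : ∀ a b c, mul a (add b c) = add (add (mul a b) (neg a)) (mul a c)

namespace SkewBrace

variable {B C Q : Type u}

/-- `λ_a (b) = -a + a ∘ b`. -/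
def lam (S : SkewBrace B) (a b : B) : B := S.add (S.neg a) (S.mul a b)

/-- `a ∗ b = λ_a(b) - b = -a + a ∘ b - b`. -/
def star (S : SkewBrace B) (a b : B) : B := S.add (S.lam a b) (S.neg b)

/-- A sub-skew brace: a subset containing the identity and closed under both group
operations and both inverses. -/
def IsSub (S : SkewBrace B) (T : Set B) : Prop :=
  S.zero ∈ T ∧ (∀ a ∈ T, ∀ b ∈ T, S.add a b ∈ T) ∧ (∀ a ∈ T, S.neg a ∈ T) ∧
    (∀ a ∈ T, ∀ b ∈ T, S.mul a b ∈ T) ∧ (∀ a ∈ T, S.inv a ∈ T)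

/-- The sub-skew brace generated by a subset. -/
def subGen (S : SkewBrace B) (X : Set B) : Set B := ⋂₀ {T | S.IsSub T ∧ X ⊆ T}

/-- A skew brace is finitely generated if a finite subset generates it. -/
def FinitelyGenerated (S : SkewBrace B) : Prop := ∃ T : Finset B, S.subGen ↑T = Set.univ

/-- A subgroup of the additive group `(B,+)`. -/
def IsAddSubgroup (S : SkewBrace B) (T : Set B) : Prop :=
  S.zero ∈ T ∧ (∀ a ∈ T, ∀ b ∈ T, S.add a b ∈ T) ∧ ∀ a ∈ T, S.neg a ∈ T

/-- A subgroup of the multiplicative group `(B,∘)`. -/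
def IsMulSubgroup (S : SkewBrace B) (T : Set B) : Prop :=
  S.zero ∈ T ∧ (∀ a ∈ T, ∀ b ∈ T, S.mul a b ∈ T) ∧ ∀ a ∈ T, S.inv a ∈ T

/-- The additive subgroup generated by a subset. -/
def addClosure (S : SkewBrace B) (X : Set B) : Set B := ⋂₀ {T | S.IsAddSubgroup T ∧ X ⊆ T}

/-- The multiplicative subgroup generated by a subset. -/
def mulClosure (S : SkewBrace B) (X : Set B) : Set B := ⋂₀ {T | S.IsMulSubgroup T ∧ X ⊆ T}

/-- The group `(B,+)` is finitely generated. -/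
def AddFG (S : SkewBrace B) : Prop := ∃ T : Finset B, S.addClosure ↑T = Set.univ

/-- The group `(B,∘)` is finitely generated. -/
def MulFG (S : SkewBrace B) : Prop := ∃ T : Finset B, S.mulClosure ↑T = Set.univ

/-- An ideal of a skew brace: a subgroup of `(B,+)`, normal in `(B,+)` and in `(B,∘)`,
invariant under all the maps `λ_b`. -/
def IsIdeal (S : SkewBrace B) (I : Set B) : Prop :=
  S.IsAddSubgroup I ∧ (∀ b : B, ∀ a ∈ I, S.add (S.add b a) (S.neg b) ∈ I) ∧
    (∀ b : B, ∀ a ∈ I, S.mul (S.mul b a) (S.inv b) ∈ I) ∧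
    ∀ b : B, ∀ a ∈ I, S.lam b a ∈ I

/-- The ideal generated by a subset (the smallest ideal containing it). -/
def idealGen (S : SkewBrace B) (X : Set B) : Set B := ⋂₀ {I | S.IsIdeal I ∧ X ⊆ I}

/-- A homomorphism of skew braces. -/
def IsHom (S : SkewBrace B) (T : SkewBrace C) (f : B → C) : Prop :=
  (∀ a b, f (S.add a b) = T.add (f a) (f b)) ∧ ∀ a b, f (S.mul a b) = T.mul (f a) (f b)

/-- `SF` together with `ι : X → F` is the free skew brace on `X`: every map from `X`
to a skew brace extends uniquely to a homomorphism. -/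
def IsFreeOn {F : Type u} {X : Type v} (SF : SkewBrace F) (ι : X → F) : Prop :=
  ∀ (C : Type u) (SC : SkewBrace C) (f : X → C),
    ∃! g : F → C, IsHom SF SC g ∧ ∀ x, g (ι x) = f x

/-- A skew brace is finitely presented if it is the image of a free skew brace on a
finite set under a homomorphism whose kernel is generated, as an ideal, by finitely
many elements. -/
def FinitelyPresented (S : SkewBrace B) : Prop :=
  ∃ (F : Type u) (SF : SkewBrace F) (m : ℕ) (ι : Fin m → F) (θ : F → B),
    IsFreeOn SF ι ∧ IsHom SF S θ ∧ Function.Surjective θ ∧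
      ∃ R : Finset F, {x | θ x = S.zero} = SF.idealGen ↑R

/-- `π : B → Q` realizes `Q` as the quotient skew brace `B/I`. -/
def IsQuotientBy (S : SkewBrace B) (I : Set B) (SQ : SkewBrace Q) (π : B → Q) : Prop :=
  IsHom S SQ π ∧ Function.Surjective π ∧ {x | π x = SQ.zero} = I

/-- The group `(B,+)` is finitely presented (as an abstract group). -/
def AddFP (S : SkewBrace B) : Prop :=
  ∃ (m : ℕ) (f : FreeGroup (Fin m) → B),
    (∀ x y, f (x * y) = S.add (f x) (f y)) ∧ Function.Surjective f ∧
      ∃ R : Finset (FreeGroup (Fin m)),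
        {x | f x = S.zero} = ↑(Subgroup.normalClosure (R : Set (FreeGroup (Fin m))))

/-- The group `(B,∘)` is finitely presented (as an abstract group). -/
def MulFP (S : SkewBrace B) : Prop :=
  ∃ (m : ℕ) (f : FreeGroup (Fin m) → B),
    (∀ x y, f (x * y) = S.mul (f x) (f y)) ∧ Function.Surjective f ∧
      ∃ R : Finset (FreeGroup (Fin m)),
        {x | f x = S.zero} = ↑(Subgroup.normalClosure (R : Set (FreeGroup (Fin m))))

/-- The ascending chain condition on sub-skew braces. -/
def SubACC (S : SkewBrace B) : Prop :=
  ∀ f : ℕ → Set B, Monotone f → (∀ n, S.IsSub (f n)) → ∃ n, ∀ m, n ≤ m → f m = f n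

/-- The ascending chain condition on subgroups of `(B,+)`. -/
def AddACC (S : SkewBrace B) : Prop :=
  ∀ f : ℕ → Set B, Monotone f → (∀ n, S.IsAddSubgroup (f n)) → ∃ n, ∀ m, n ≤ m → f m = f n

/-- The socle `Soc(B) = Ker(λ) ∩ Z(B,+)`. -/
def soc (S : SkewBrace B) : Set B :=
  {x | (∀ b, S.lam x b = b) ∧ ∀ b, S.add x b = S.add b x}

/-- The centre of the additive group `(B,+)`. -/
def addCenter (S : SkewBrace B) : Set B := {x | ∀ b, S.add x b = S.add b x}

/-- The preimage in `B` of `Ann(B/I)` (for `I` an ideal): the set of `x` such that,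
modulo `I`, `λ_x = id`, `x` is central in `(B,+)` and `x` is central in `(B,∘)`. -/
def annStep (S : SkewBrace B) (I : Set B) : Set B :=
  {x | (∀ b, S.add (S.lam x b) (S.neg b) ∈ I) ∧
       (∀ b, S.add (S.add x b) (S.neg (S.add b x)) ∈ I) ∧
       ∀ b, S.mul (S.mul x b) (S.inv (S.mul b x)) ∈ I}

/-- The preimage in `B` of `Soc(B/I)` (for `I` an ideal). -/
def socStep (S : SkewBrace B) (I : Set B) : Set B :=
  {x | (∀ b, S.add (S.lam x b) (S.neg b) ∈ I) ∧
       ∀ b, S.add (S.add x b) (S.neg (S.add b x)) ∈ I}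

/-- The upper annihilator series `Ann_α(B)`, defined by transfinite recursion. -/
noncomputable def annSeries (S : SkewBrace B) (o : Ordinal.{v}) : Set B :=
  Ordinal.limitRecOn o {S.zero} (fun _ ih => S.annStep ih)
    fun _o _ ih => ⋃ β, ⋃ h : β < _o, ih β h

/-- The upper socle series `Soc_α(B)`, defined by transfinite recursion. -/
noncomputable def socSeries (S : SkewBrace B) (o : Ordinal.{v}) : Set B :=
  Ordinal.limitRecOn o {S.zero} (fun _ ih => S.socStep ih)
    fun _o _ ih => ⋃ β, ⋃ h : β < _o, ih β h

/-- The solution of the YBE associated with a skew brace: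
`r_B(a,b) = (λ_a(b), λ_a(b)⁻¹ ∘ a ∘ b)`. -/
def braceR (S : SkewBrace B) : B × B → B × B :=
  fun p => (S.lam p.1 p.2, S.mul (S.inv (S.lam p.1 p.2)) (S.mul p.1 p.2))

end SkewBrace

/-- The set-theoretic Yang–Baxter (braid) equation
`(r × id)(id × r)(r × id) = (id × r)(r × id)(id × r)`. -/
def ybe {X : Type u} (r : X × X → X × X) : Prop :=
  let r₁ : X × X × X → X × X × X := fun p =>
    ((r (p.1, p.2.1)).1, (r (p.1, p.2.1)).2, p.2.2)
  let r₂ : X × X × X → X × X × X := fun p => (p.1, r p.2)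
  r₁ ∘ r₂ ∘ r₁ = r₂ ∘ r₁ ∘ r₂

/-- A non-degenerate set-theoretic solution: `r` is bijective, satisfies the YBE, and
writing `r (x,y) = (σ_x y, τ_y x)`, all maps `σ_x` and `τ_y` are bijective. -/
def IsNonDegenerateSolution {X : Type u} (r : X × X → X × X) : Prop :=
  Function.Bijective r ∧ ybe r ∧
    (∀ x, Function.Bijective fun y => (r (x, y)).1) ∧
    ∀ y, Function.Bijective fun x => (r (x, y)).2

/-- `S` (with the distinguished map `ι : X → B`) is the structure skew brace of the
solution `(X,r)`: the multiplicative group of `S` is the structure group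
`G(X,r) = ⟨X | x y = σ_x(y) τ_y(x)⟩` (expressed by the relations holding together
with the universal property of the presentation) and `r_S ∘ (ι × ι) = (ι × ι) ∘ r`. -/
def IsStructureSkewBrace {X B : Type u} (r : X × X → X × X)
    (S : SkewBrace B) (ι : X → B) : Prop :=
  (∀ x y, S.mul (ι x) (ι y) = S.mul (ι (r (x, y)).1) (ι (r (x, y)).2)) ∧
  (∀ (H : Type u) [Group H] (f : X → H),
      (∀ x y, f x * f y = f (r (x, y)).1 * f (r (x, y)).2) →
      ∃! φ : B → H, (∀ a b, φ (S.mul a b) = φ a * φ b) ∧ ∀ x, φ (ι x) = f x) ∧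
  ∀ x y, S.braceR (ι x, ι y) = (ι (r (x, y)).1, ι (r (x, y)).2)

section KernelsOfFinitelyGeneratedGroups

/-- Every surjection from a finitely generated group onto `E` has a kernel which is the normal
closure of a finite set. -/
def AddGroup.KernelsFinitelyNormallyGenerated (E : Type u) [AddGroup E] : Prop :=
  ∀ (Γ : Type u) [AddGroup Γ] [AddGroup.FG Γ] (f : Γ →+ E), Function.Surjective f →
    f.ker.IsFinitelyNormallyGenerated

theorem AddSubgroup.fg_of_addCommGroup_fg {A : Type*} [AddCommGroup A] [AddGroup.FG A]
    (K : AddSubgroup A) : K.FG := by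
  have h : Module.Finite ℤ A := Module.Finite.iff_addGroup_fg.mpr inferInstance
  have h2 : IsNoetherian ℤ A := isNoetherian_of_isNoetherianRing_of_finite ℤ A
  have h3 := IsNoetherian.noetherian (AddSubgroup.toIntSubmodule K)
  rw [Submodule.fg_iff_addSubgroup_fg] at h3
  simpa using h3

/-- A subgroup of a finitely generated central subgroup is finitely generated. -/
theorem AddSubgroup.fg_of_le_center {A : Type*} [AddGroup A] {L K : AddSubgroup A}
    (hL : L.FG) (hc : L ≤ AddSubgroup.center A) (hK : K ≤ L) : K.FG := by
  let : AddCommGroup L :=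
    { (inferInstance : AddGroup L) with
      add_comm := fun a b => Subtype.ext ((AddSubgroup.mem_center_iff.mp (hc b.2) a)) }
  have : AddGroup.FG L := (AddGroup.fg_iff_addSubgroup_fg L).mpr hL
  have h := (K.addSubgroupOf L).fg_of_addCommGroup_fg
  obtain ⟨s, hs, hfin⟩ := (AddSubgroup.fg_iff _).mp h
  refine (AddSubgroup.fg_iff _).mpr ⟨L.subtype '' s, ?_, hfin.image _⟩
  rw [← AddMonoidHom.map_closure, hs, AddSubgroup.addSubgroupOf, AddSubgroup.map_comap_eq,
    AddSubgroup.range_subtype, inf_eq_right.mpr hK]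

/-- If `E / A` has finitely normally generated kernels and `A` is central, then so does `E`. -/
theorem AddGroup.KernelsFinitelyNormallyGenerated.of_central_extension {E Q : Type u}
    [AddGroup E] [AddGroup Q] (hQ : KernelsFinitelyNormallyGenerated Q) (g : E →+ Q)
    (hg : Function.Surjective g) (hc : g.ker ≤ AddSubgroup.center E) :
    KernelsFinitelyNormallyGenerated E := by
  intro Γ _ _ f hf
  obtain ⟨R, hRfin, hR⟩ := hQ Γ (g.comp f) (hg.comp hf)
  obtain ⟨X, hX, hXfin⟩ := AddGroup.fg_iff.mp ‹AddGroup.FG Γ›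
  set N : AddSubgroup Γ :=
    AddSubgroup.normalClosure (Set.image2 (fun r x => r + x + -r + -x) R X) with hN
  let π := QuotientAddGroup.mk' N
  have hπ : Function.Surjective π := QuotientAddGroup.mk'_surjective N
  have hπN : ∀ x, π x = 0 ↔ x ∈ N := fun x => QuotientAddGroup.eq_zero_iff x
  have hRL : ∀ r ∈ R, f r ∈ g.ker := fun r hr => by
    have : r ∈ (g.comp f).ker := hR ▸ AddSubgroup.subset_normalClosure hr
    simpa using this
  have hNf : N ≤ f.ker := by
    refine AddSubgroup.normalClosure_le_normal ?_
    rintro _ ⟨r, hr, x, -, rfl⟩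
    have h := AddSubgroup.mem_center_iff.mp (hc (hRL r hr)) (f x)
    simp [AddMonoidHom.mem_ker, ← h]
  have hRc : ∀ r ∈ R, π r ∈ AddSubgroup.center (Γ ⧸ N) := by
    intro r hr
    have hle : (⊤ : AddSubgroup Γ) ≤ (AddSubgroup.centralizer {π r}).comap π := by
      rw [← hX, AddSubgroup.closure_le]
      intro x hx
      have h : π (r + x + -r + -x) = 0 :=
        (hπN _).mpr (AddSubgroup.subset_normalClosure ⟨r, hr, x, hx, rfl⟩)
      have h2 : π r + π x = π x + π r := by
        have h3 : π r + π x + -π r + -π x = 0 := by simpa only [map_add, map_neg] using h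
        have h4 := eq_neg_of_add_eq_zero_left h3
        rw [neg_neg] at h4
        exact eq_add_of_add_neg_eq h4
      simp [AddSubgroup.mem_centralizer_iff, h2]
    refine AddSubgroup.mem_center_iff.mpr fun y => ?_
    obtain ⟨y, rfl⟩ := hπ y
    have h := hle (AddSubgroup.mem_top y)
    exact ((AddSubgroup.mem_centralizer_iff.mp h) _ rfl).symm
  have hclc : AddSubgroup.closure (π '' R) ≤ AddSubgroup.center (Γ ⧸ N) := by
    rw [AddSubgroup.closure_le]
    rintro _ ⟨r, hr, rfl⟩
    exact hRc r hr
  have hnorm : (AddSubgroup.closure (π '' R)).Normal :=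
    ⟨fun n hn y => by
      rw [AddSubgroup.mem_center_iff.mp (hclc hn) y, add_neg_cancel_right]; exact hn⟩
  have hK : f.ker.map π ≤ AddSubgroup.closure (π '' R) := by
    have h1 : f.ker ≤ (g.comp f).ker := fun x hx => by
      simp only [AddMonoidHom.mem_ker, AddMonoidHom.comp_apply] at hx ⊢
      rw [hx, map_zero]
    refine (AddSubgroup.map_mono h1).trans ?_
    rw [← hR, AddSubgroup.map_normalClosure _ _ hπ]
    exact AddSubgroup.normalClosure_le_normal AddSubgroup.subset_closure
  have hfg : (f.ker.map π).FG :=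
    AddSubgroup.fg_of_le_center ((AddSubgroup.fg_iff _).mpr ⟨_, rfl, hRfin.image _⟩) hclc hK
  have : AddGroup.FG (f.ker.map π) := (AddGroup.fg_iff_addSubgroup_fg _).mpr hfg
  have : (f.ker.map π).Normal := AddSubgroup.Normal.map inferInstance π hπ
  have hker : π.ker = N := QuotientAddGroup.ker_mk' N
  have h := (AddSubgroup.IsFinitelyNormallyGenerated.of_FG (f.ker.map π)).comap hπ
    (by rw [hker]; exact ⟨_, hRfin.image2 _ hXfin, rfl⟩)
  rwa [AddSubgroup.comap_map_eq, hker, sup_eq_left.mpr hNf] at h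

end KernelsOfFinitelyGeneratedGroups

namespace SkewBrace

section Basic

variable {B C : Type u} (S : SkewBrace B) {T : SkewBrace C}

/-- The additive group of a skew brace. -/
abbrev addGroup : AddGroup B where
  add := S.add
  zero := S.zero
  neg := S.neg
  add_assoc := S.add_assoc
  zero_add := S.zero_add
  add_zero := S.add_zero
  neg_add_cancel := S.neg_add
  nsmul := @nsmulRec B ⟨S.zero⟩ ⟨S.add⟩
  zsmul := @zsmulRec B ⟨S.zero⟩ ⟨S.add⟩ ⟨S.neg⟩ (@nsmulRec B ⟨S.zero⟩ ⟨S.add⟩)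

/-- The multiplicative group of a skew brace. -/
abbrev mulGroup : Group B where
  mul := S.mul
  one := S.zero
  inv := S.inv
  mul_assoc := S.mul_assoc
  one_mul := S.zero_mul
  mul_one := S.mul_zero
  inv_mul_cancel := S.inv_mul
  npow := @npowRec B ⟨S.zero⟩ ⟨S.mul⟩
  zpow := @zpowRec B ⟨S.zero⟩ ⟨S.mul⟩ ⟨S.inv⟩ (@npowRec B ⟨S.zero⟩ ⟨S.mul⟩)

theorem add_neg_cancel_left (a b : B) : S.add a (S.add (S.neg a) b) = b :=
  @_root_.add_neg_cancel_left B S.addGroup a b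

theorem mul_inv_cancel_left (a b : B) : S.mul a (S.mul (S.inv a) b) = b :=
  @_root_.mul_inv_cancel_left B S.mulGroup a b

theorem inv_inv (a : B) : S.inv (S.inv a) = a :=
  @_root_.inv_inv B S.mulGroup.toDivisionMonoid.toInvolutiveInv a

theorem mul_inv_rev (a b : B) : S.inv (S.mul a b) = S.mul (S.inv b) (S.inv a) :=
  @_root_.mul_inv_rev B S.mulGroup.toDivisionMonoid a b

theorem neg_neg (a : B) : S.neg (S.neg a) = a :=
  @_root_.neg_neg B S.addGroup.toSubtractionMonoid.toInvolutiveNeg a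

theorem add_neg_eq_zero {a b : B} : S.add a (S.neg b) = S.zero ↔ a = b :=
  @_root_.add_neg_eq_zero B S.addGroup a b

theorem add_lam (a b : B) : S.add a (S.lam a b) = S.mul a b := S.add_neg_cancel_left a _

theorem lam_add (a b c : B) : S.lam a (S.add b c) = S.add (S.lam a b) (S.lam a c) := by
  simp only [lam, S.compat, S.add_assoc]

theorem lam_zero (a : B) : S.lam a S.zero = S.zero := by
  simp only [lam, S.mul_zero, S.neg_add]

theorem zero_lam (b : B) : S.lam S.zero b = b := by
  have h := S.add_lam S.zero b
  rwa [S.zero_add, S.zero_mul] at h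

theorem lam_neg (a b : B) : S.lam a (S.neg b) = S.neg (S.lam a b) := by
  let := S.addGroup
  have h : S.lam a (S.neg b) + S.lam a b = 0 := by
    change S.add _ _ = S.zero
    rw [← lam_add, S.neg_add, lam_zero]
  exact eq_neg_of_add_eq_zero_left h

theorem mul_lam (a b c : B) : S.lam (S.mul a b) c = S.lam a (S.lam b c) := by
  have h : S.add (S.mul a b) (S.lam (S.mul a b) c) = S.add (S.mul a b) (S.lam a (S.lam b c)) := by
    rw [add_lam, S.mul_assoc, ← S.add_lam a (S.mul b c), ← S.add_lam b c, S.lam_add,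
      ← S.add_assoc, S.add_lam]
  let := S.addGroup
  exact add_left_cancel (a := S.mul a b) h

theorem lam_inv_lam (a b : B) : S.lam a (S.lam (S.inv a) b) = b := by
  rw [← mul_lam, S.mul_inv, zero_lam]

theorem inv_lam_lam (a b : B) : S.lam (S.inv a) (S.lam a b) = b := by
  rw [← mul_lam, S.inv_mul, zero_lam]

theorem inv_eq (a : B) : S.inv a = S.neg (S.lam (S.inv a) a) := by
  let := S.addGroup
  have h : S.inv a + S.lam (S.inv a) a = 0 := by
    change S.add _ _ = S.zero
    rw [add_lam, S.inv_mul]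
  exact eq_neg_of_add_eq_zero_left h

variable {S}

namespace IsHom

variable {f : B → C} (hf : S.IsHom T f)
include hf

theorem map_zero : f S.zero = T.zero := by
  have h := hf.1 S.zero S.zero
  rw [S.zero_add] at h
  let := T.addGroup
  exact (add_eq_left (a := f S.zero)).mp h.symm

theorem map_neg (a : B) : f (S.neg a) = T.neg (f a) := by
  let := T.addGroup
  have h : f (S.neg a) + f a = 0 := by
    change T.add _ _ = T.zero
    rw [← hf.1, S.neg_add, hf.map_zero]
  exact eq_neg_of_add_eq_zero_left h

theorem map_inv (a : B) : f (S.inv a) = T.inv (f a) := by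
  let := T.mulGroup
  have h : f (S.inv a) * f a = 1 := by
    change T.mul _ _ = T.zero
    rw [← hf.2, S.inv_mul, hf.map_zero]
  exact eq_inv_of_mul_eq_one_left h

theorem map_lam (a b : B) : f (S.lam a b) = T.lam (f a) (f b) := by
  simp only [lam, hf.1, hf.2, hf.map_neg]

theorem isSub_preimage {U : Set C} (hU : T.IsSub U) : S.IsSub (f ⁻¹' U) := by
  obtain ⟨h0, ha, hn, hm, hi⟩ := hU
  refine ⟨?_, fun a ha' b hb => ?_, fun a ha' => ?_, fun a ha' b hb => ?_, fun a ha' => ?_⟩ <;>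
    simp only [Set.mem_preimage, hf.1, hf.2, hf.map_neg, hf.map_inv, hf.map_zero] at * <;>
    solve_by_elim

theorem finitelyGenerated (hs : Function.Surjective f) (h : S.FinitelyGenerated) :
    T.FinitelyGenerated := by
  classical
  obtain ⟨X, hX⟩ := h
  refine ⟨X.image f, Set.eq_univ_of_forall fun c => ?_⟩
  rintro U ⟨hU, hXU⟩
  obtain ⟨b, rfl⟩ := hs c
  have hb : b ∈ S.subGen X := hX ▸ Set.mem_univ b
  exact hb _ ⟨hf.isSub_preimage hU, fun x hx => hXU (by simpa using ⟨x, hx, rfl⟩)⟩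

theorem isIdeal_preimage {I : Set C} (hI : T.IsIdeal I) : S.IsIdeal (f ⁻¹' I) := by
  obtain ⟨⟨h0, ha, hn⟩, hna, hnm, hl⟩ := hI
  refine ⟨⟨?_, fun a ha' b hb => ?_, fun a ha' => ?_⟩, fun a b hb => ?_, fun a b hb => ?_,
      fun a b hb => ?_⟩ <;>
    simp only [Set.mem_preimage, hf.1, hf.2, hf.map_neg, hf.map_inv, hf.map_zero,
      hf.map_lam] at * <;>
    solve_by_elim

end IsHom

theorem isIdeal_zero : S.IsIdeal {S.zero} := by
  refine ⟨⟨rfl, ?_, ?_⟩, ?_, ?_, ?_⟩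
  · rintro _ rfl _ rfl
    exact S.zero_add _
  · rintro _ rfl
    have h := S.neg_add S.zero
    rwa [S.add_zero] at h
  · rintro b _ rfl
    rw [S.add_zero, S.add_neg]; rfl
  · rintro b _ rfl
    rw [S.mul_zero, S.mul_inv]; rfl
  · rintro b _ rfl
    exact S.lam_zero b

theorem IsHom.isIdeal_ker {f : B → C} (hf : S.IsHom T f) : S.IsIdeal {x | f x = T.zero} :=
  hf.isIdeal_preimage isIdeal_zero

theorem subset_idealGen (X : Set B) : X ⊆ S.idealGen X := fun _ hx _ hI => hI.2 hx

theorem idealGen_subset {X I : Set B} (hI : S.IsIdeal I) (h : X ⊆ I) : S.idealGen X ⊆ I :=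
  fun _ hx => hx I ⟨hI, h⟩

theorem isIdeal_idealGen (X : Set B) : S.IsIdeal (S.idealGen X) :=
  ⟨⟨fun _ hI => hI.1.1.1, fun _ ha _ hb I hI => hI.1.1.2.1 _ (ha I hI) _ (hb I hI),
    fun _ ha I hI => hI.1.1.2.2 _ (ha I hI)⟩, fun b _ ha I hI => hI.1.2.1 b _ (ha I hI),
    fun b _ ha I hI => hI.1.2.2.1 b _ (ha I hI), fun b _ ha I hI => hI.1.2.2.2 b _ (ha I hI)⟩

theorem IsHom.mem_ker_of_eq {f : B → C} (hf : S.IsHom T f) {a b : B} (h : f a = f b) :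
    f (S.add a (S.neg b)) = T.zero := by
  rw [hf.1, hf.map_neg, h, T.add_neg]

theorem conj_eq_lam_of_mem_soc {a : B} (ha : a ∈ S.soc) (b : B) :
    S.mul (S.mul b a) (S.inv b) = S.lam b a := by
  have h : S.mul a (S.inv b) = S.add a (S.inv b) := by rw [← add_lam, ha.1]
  have h2 : S.add b (S.lam b (S.inv b)) = S.zero := by rw [add_lam, S.mul_inv]
  rw [S.mul_assoc, h, ha.2, ← add_lam, lam_add, ← S.add_assoc, h2, S.zero_add]

theorem add_eq_mul_of_mem_soc {a b : B} (ha : a ∈ S.soc) : S.add a b = S.mul a b := by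
  rw [← add_lam, ha.1]

theorem inv_lam_of_mem_soc {a : B} (ha : a ∈ S.soc) (b : B) : S.lam (S.inv a) b = b := by
  have h := S.inv_lam_lam a b
  rwa [ha.1] at h

theorem neg_eq_inv_of_mem_soc {a : B} (ha : a ∈ S.soc) : S.neg a = S.inv a := by
  rw [inv_eq, inv_lam_of_mem_soc ha]

theorem isIdeal_soc : S.IsIdeal S.soc := by
  have hlam := fun b a (ha : a ∈ S.soc) => conj_eq_lam_of_mem_soc ha b
  have hmem : ∀ b, ∀ a ∈ S.soc, S.lam b a ∈ S.soc := by
    intro b a ha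
    refine ⟨fun c => ?_, fun c => ?_⟩
    · rw [← hlam b a ha, mul_lam, mul_lam, ha.1, lam_inv_lam]
    · rw [← S.lam_inv_lam b c, ← lam_add, ← lam_add, ha.2]
  refine ⟨⟨⟨S.zero_lam, fun b => by rw [S.zero_add, S.add_zero]⟩, fun a ha b hb => ?_,
    fun a ha => ?_⟩, fun b a ha => ?_, fun b a ha => ?_, hmem⟩
  · refine ⟨fun c => by rw [add_eq_mul_of_mem_soc ha, mul_lam, hb.1, ha.1], fun c => ?_⟩
    rw [S.add_assoc, hb.2, ← S.add_assoc, ha.2, S.add_assoc]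
  · refine ⟨fun c => by rw [neg_eq_inv_of_mem_soc ha, inv_lam_of_mem_soc ha], fun c => ?_⟩
    let := S.addGroup
    have h : AddCommute a c := ha.2 c
    exact h.neg_left
  · rw [← ha.2, S.add_assoc, S.add_neg, S.add_zero]
    exact ha
  · rw [hlam b a ha]
    exact hmem b a ha

namespace IsIdeal

variable {I : Set B} (hI : S.IsIdeal I)
include hI

theorem neg_add_mem_iff {a b : B} : S.add (S.neg a) b ∈ I ↔ S.mul (S.inv a) b ∈ I := by
  have h : S.add (S.neg a) b = S.lam a (S.mul (S.inv a) b) := by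
    rw [lam, mul_inv_cancel_left]
  rw [h]
  refine ⟨fun h' => ?_, hI.2.2.2 a _⟩
  have := hI.2.2.2 (S.inv a) _ h'
  rwa [inv_lam_lam] at this

/-- Congruence modulo an ideal, as a congruence of the additive group. -/
theorem exists_addCon : ∃ c : @AddCon B S.addGroup.toAdd,
    ∀ a b, c a b ↔ S.add (S.neg a) b ∈ I := by
  let := S.addGroup
  let A : AddSubgroup B :=
    { carrier := I
      zero_mem' := hI.1.1
      add_mem' := fun {a b} ha hb => hI.1.2.1 a ha b hb
      neg_mem' := fun {a} ha => hI.1.2.2 a ha }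
  have : A.Normal := ⟨fun n hn g => hI.2.1 g n hn⟩
  exact ⟨QuotientAddGroup.con A, fun a b => QuotientAddGroup.leftRel_apply⟩

/-- Congruence modulo an ideal, as a congruence of the multiplicative group. -/
theorem exists_con : ∃ c : @Con B S.mulGroup.toMul,
    ∀ a b, c a b ↔ S.add (S.neg a) b ∈ I := by
  let := S.mulGroup
  let M : Subgroup B :=
    { carrier := I
      one_mem' := hI.1.1
      mul_mem' := fun {a b} ha hb => by
        change S.mul a b ∈ I
        rw [← add_lam]
        exact hI.1.2.1 _ ha _ (hI.2.2.2 _ _ hb)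
      inv_mem' := fun {a} ha => by
        change S.inv a ∈ I
        rw [inv_eq]
        exact hI.1.2.2 _ (hI.2.2.2 _ _ ha) }
  have : M.Normal := ⟨fun n hn g => hI.2.2.1 g n hn⟩
  exact ⟨QuotientGroup.con M, fun a b =>
    QuotientGroup.leftRel_apply.trans hI.neg_add_mem_iff.symm⟩

/-- The quotient of a skew brace by an ideal exists. -/
theorem exists_quotient : ∃ (Q : Type u) (SQ : SkewBrace Q) (π : B → Q),
    S.IsQuotientBy I SQ π := by
  obtain ⟨c, hc⟩ := hI.exists_addCon
  obtain ⟨d, hd⟩ := hI.exists_con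
  let := S.addGroup
  let := S.mulGroup
  let s : Setoid B := c.toSetoid
  have hs : ∀ a b, s a b ↔ d a b := fun a b => (hc a b).trans (hd a b).symm
  let SQ : SkewBrace (Quotient s) :=
    { add := Quotient.map₂ S.add fun _ _ h _ _ h' => (c.add h h' : c _ _)
      zero := Quotient.mk s S.zero
      neg := Quotient.map S.neg fun _ _ h => (c.neg h : c _ _)
      mul := Quotient.map₂ S.mul fun _ _ h _ _ h' =>
        (hs _ _).mpr (d.mul ((hs _ _).mp h) ((hs _ _).mp h'))
      inv := Quotient.map S.inv fun _ _ h =>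
        (hs _ _).mpr (d.inv ((hs _ _).mp h))
      add_assoc := by
        rintro ⟨a⟩ ⟨b⟩ ⟨c⟩; exact congrArg (Quotient.mk s) (S.add_assoc a b c)
      zero_add := by rintro ⟨a⟩; exact congrArg (Quotient.mk s) (S.zero_add a)
      add_zero := by rintro ⟨a⟩; exact congrArg (Quotient.mk s) (S.add_zero a)
      neg_add := by rintro ⟨a⟩; exact congrArg (Quotient.mk s) (S.neg_add a)
      add_neg := by rintro ⟨a⟩; exact congrArg (Quotient.mk s) (S.add_neg a)
      mul_assoc := by
        rintro ⟨a⟩ ⟨b⟩ ⟨c⟩; exact congrArg (Quotient.mk s) (S.mul_assoc a b c)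
      zero_mul := by rintro ⟨a⟩; exact congrArg (Quotient.mk s) (S.zero_mul a)
      mul_zero := by rintro ⟨a⟩; exact congrArg (Quotient.mk s) (S.mul_zero a)
      inv_mul := by rintro ⟨a⟩; exact congrArg (Quotient.mk s) (S.inv_mul a)
      mul_inv := by rintro ⟨a⟩; exact congrArg (Quotient.mk s) (S.mul_inv a)
      compat := by
        rintro ⟨a⟩ ⟨b⟩ ⟨c⟩; exact congrArg (Quotient.mk s) (S.compat a b c) }
  refine ⟨Quotient s, SQ, Quotient.mk s, ⟨fun _ _ => rfl, fun _ _ => rfl⟩,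
    Quotient.mk_surjective, ?_⟩
  ext x
  have h : Quotient.mk s x = Quotient.mk s S.zero ↔ S.neg x ∈ I := by
    rw [Quotient.eq]
    exact (hc x S.zero).trans (by rw [S.add_zero])
  refine h.trans ⟨fun hx => ?_, hI.1.2.2 x⟩
  have := hI.1.2.2 _ hx
  rwa [S.neg_neg] at this

end IsIdeal

end Basic

section Free

/-- Formal terms in the language of skew braces. -/
inductive Term (X : Type) : Type u
  | var (x : X) : Term X
  | zero : Term X
  | add (s t : Term X) : Term X
  | neg (s : Term X) : Term X
  | mul (s t : Term X) : Term X
  | inv (s : Term X) : Term X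

/-- Evaluation of a formal term in a skew brace. -/
def Term.eval {X : Type} {C : Type u} (S : SkewBrace C) (f : X → C) : Term.{u} X → C
  | var x => f x
  | zero => S.zero
  | add s t => S.add (s.eval S f) (t.eval S f)
  | neg s => S.neg (s.eval S f)
  | mul s t => S.mul (s.eval S f) (t.eval S f)
  | inv s => S.inv (s.eval S f)

/-- Two terms are identified when they agree under every evaluation in a skew brace. -/
def Term.setoid (X : Type) : Setoid (Term.{u} X) where
  r s t := ∀ (C : Type u) (S : SkewBrace C) (f : X → C), s.eval S f = t.eval S f
  iseqv := ⟨fun _ _ _ _ => rfl, fun h C S f => (h C S f).symm,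
    fun h h' C S f => (h C S f).trans (h' C S f)⟩

/-- The skew brace of formal terms modulo the identities of skew braces. -/
def free (X : Type) : SkewBrace (Quotient (Term.setoid.{u} X)) where
  add := Quotient.map₂ .add fun _ _ h _ _ h' C S f => congrArg₂ S.add (h C S f) (h' C S f)
  zero := Quotient.mk _ .zero
  neg := Quotient.map .neg fun _ _ h C S f => congrArg S.neg (h C S f)
  mul := Quotient.map₂ .mul fun _ _ h _ _ h' C S f => congrArg₂ S.mul (h C S f) (h' C S f)
  inv := Quotient.map .inv fun _ _ h C S f => congrArg S.inv (h C S f)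
  add_assoc := by rintro ⟨a⟩ ⟨b⟩ ⟨c⟩; exact Quotient.sound fun C S f => S.add_assoc _ _ _
  zero_add := by rintro ⟨a⟩; exact Quotient.sound fun C S f => S.zero_add _
  add_zero := by rintro ⟨a⟩; exact Quotient.sound fun C S f => S.add_zero _
  neg_add := by rintro ⟨a⟩; exact Quotient.sound fun C S f => S.neg_add _
  add_neg := by rintro ⟨a⟩; exact Quotient.sound fun C S f => S.add_neg _
  mul_assoc := by rintro ⟨a⟩ ⟨b⟩ ⟨c⟩; exact Quotient.sound fun C S f => S.mul_assoc _ _ _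
  zero_mul := by rintro ⟨a⟩; exact Quotient.sound fun C S f => S.zero_mul _
  mul_zero := by rintro ⟨a⟩; exact Quotient.sound fun C S f => S.mul_zero _
  inv_mul := by rintro ⟨a⟩; exact Quotient.sound fun C S f => S.inv_mul _
  mul_inv := by rintro ⟨a⟩; exact Quotient.sound fun C S f => S.mul_inv _
  compat := by rintro ⟨a⟩ ⟨b⟩ ⟨c⟩; exact Quotient.sound fun C S f => S.compat _ _ _

/-- The canonical generators of the free skew brace. -/
def freeOf {X : Type} (x : X) : Quotient (Term.setoid.{u} X) := Quotient.mk _ (.var x)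

theorem eq_univ_of_isSub_free {X : Type} {U : Set (Quotient (Term.setoid.{u} X))}
    (hU : (free X).IsSub U) (h : ∀ x, freeOf x ∈ U) : U = Set.univ := by
  obtain ⟨h0, ha, hn, hm, hi⟩ := hU
  refine Set.eq_univ_of_forall ?_
  rintro ⟨t⟩
  induction t with
  | var x => exact h x
  | zero => exact h0
  | add s t hs ht => exact ha _ hs _ ht
  | neg s hs => exact hn _ hs
  | mul s t hs ht => exact hm _ hs _ ht
  | inv s hs => exact hi _ hs

theorem IsHom.isSub_eqLocus {B C : Type u} {S : SkewBrace B} {T : SkewBrace C} {f g : B → C}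
    (hf : S.IsHom T f) (hg : S.IsHom T g) : S.IsSub {x | f x = g x} := by
  refine ⟨?_, fun a ha b hb => ?_, fun a ha => ?_, fun a ha b hb => ?_, fun a ha => ?_⟩ <;>
    simp_all [hf.1, hf.2, hf.map_neg, hf.map_inv, hf.map_zero, hg.1, hg.2, hg.map_neg,
      hg.map_inv, hg.map_zero]

theorem isFreeOn_free (X : Type) : IsFreeOn (free.{u} X) (freeOf (X := X)) := by
  intro C SC f
  have hex : IsHom (free X) SC (Quotient.lift (Term.eval SC f) fun _ _ h => h C SC f) :=
    ⟨by rintro ⟨a⟩ ⟨b⟩; rfl, by rintro ⟨a⟩ ⟨b⟩; rfl⟩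
  refine ⟨_, ⟨hex, fun x => rfl⟩, fun g hg => ?_⟩
  have h := eq_univ_of_isSub_free (hg.1.isSub_eqLocus hex) hg.2
  exact funext fun x => Set.eq_univ_iff_forall.mp h x

theorem finitelyGenerated_free (X : Type) [Finite X] : (free.{u} X).FinitelyGenerated := by
  refine ⟨(Set.finite_range freeOf).toFinset, Set.eq_univ_of_forall fun x U hU => ?_⟩
  rw [eq_univ_of_isSub_free hU.1 fun x => hU.2 (by simp)]
  trivial

theorem FinitelyGenerated.exists_free_surjective {B : Type u} {S : SkewBrace B}
    (h : S.FinitelyGenerated) : ∃ (m : ℕ) (θ : Quotient (Term.setoid.{u} (Fin m)) → B),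
      IsHom (free (Fin m)) S θ ∧ Function.Surjective θ := by
  obtain ⟨X, hX⟩ := h
  obtain ⟨θ, ⟨hθ, hθX⟩, -⟩ := isFreeOn_free (Fin X.card) B S fun i => (X.equivFin.symm i : B)
  refine ⟨X.card, θ, hθ, fun b => ?_⟩
  have hb : b ∈ S.subGen X := hX ▸ Set.mem_univ b
  refine hb (Set.range θ) ⟨⟨⟨_, hθ.map_zero⟩, ?_, ?_, ?_, ?_⟩, fun x hx =>
    ⟨freeOf (X.equivFin ⟨x, hx⟩), by simp [hθX]⟩⟩
  · rintro _ ⟨a, rfl⟩ _ ⟨b, rfl⟩; exact ⟨_, hθ.1 a b⟩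
  · rintro _ ⟨a, rfl⟩; exact ⟨_, hθ.map_neg a⟩
  · rintro _ ⟨a, rfl⟩ _ ⟨b, rfl⟩; exact ⟨_, hθ.2 a b⟩
  · rintro _ ⟨a, rfl⟩; exact ⟨_, hθ.map_inv a⟩

end Free

section KernelsOfFinitelyGeneratedBraces

variable {B C G : Type u} {S : SkewBrace B} {SC : SkewBrace C} {SG : SkewBrace G}

theorem AddFG.eq_univ (h : S.AddFG) :
    ∃ X : Finset B, ∀ T, S.IsAddSubgroup T → ↑X ⊆ T → T = Set.univ :=
  h.imp fun _ hX _ hT hXT =>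
    Set.eq_univ_of_forall fun b => (hX ▸ Set.mem_univ b : b ∈ S.addClosure _) _ ⟨hT, hXT⟩

theorem MulFG.eq_univ (h : S.MulFG) :
    ∃ X : Finset B, ∀ T, S.IsMulSubgroup T → ↑X ⊆ T → T = Set.univ :=
  h.imp fun _ hX _ hT hXT =>
    Set.eq_univ_of_forall fun b => (hX ▸ Set.mem_univ b : b ∈ S.mulClosure _) _ ⟨hT, hXT⟩

theorem FinitelyGenerated.eq_univ (h : S.FinitelyGenerated) :
    ∃ X : Finset B, ∀ T, S.IsSub T → ↑X ⊆ T → T = Set.univ :=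
  h.imp fun _ hX _ hT hXT =>
    Set.eq_univ_of_forall fun b => (hX ▸ Set.mem_univ b : b ∈ S.subGen _) _ ⟨hT, hXT⟩

/-- The additive group of `S` has finitely normally generated kernels. -/
def AddKernelsFG (S : SkewBrace B) : Prop :=
  @AddGroup.KernelsFinitelyNormallyGenerated B S.addGroup

/-- The elements `v` of an additive subgroup `T` such that `T` is invariant under `λ_v` and its
inverse form a multiplicative subgroup. -/
theorem IsAddSubgroup.isMulSubgroup_stabilizer {T : Set B} (hT : S.IsAddSubgroup T) :
    S.IsMulSubgroup {v | v ∈ T ∧ (∀ t ∈ T, S.lam v t ∈ T) ∧ ∀ t ∈ T, S.lam (S.inv v) t ∈ T} := by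
  have h0 : S.inv S.zero = S.zero := by
    have h := S.inv_mul S.zero
    rwa [S.mul_zero] at h
  refine ⟨⟨hT.1, by simp [zero_lam], by simp [h0, zero_lam]⟩, ?_, ?_⟩
  · rintro a ⟨ha, ha1, ha2⟩ b ⟨hb, hb1, hb2⟩
    refine ⟨?_, fun t ht => ?_, fun t ht => ?_⟩
    · rw [← add_lam]
      exact hT.2.1 _ ha _ (ha1 _ hb)
    · rw [mul_lam]
      exact ha1 _ (hb1 _ ht)
    · rw [mul_inv_rev, mul_lam]
      exact hb2 _ (ha2 _ ht)
  · rintro a ⟨ha, ha1, ha2⟩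
    refine ⟨?_, ha2, by rwa [inv_inv]⟩
    rw [inv_eq]
    exact hT.2.2 _ (ha2 _ ha)

/-- If `(C,+)` and `(C,∘)` are finitely generated and `(C,+)` has finitely normally generated
kernels, then every surjection from a finitely generated skew brace onto `C` has a kernel which is
finitely generated as an ideal. -/
theorem exists_finset_ker_eq_idealGen (hA : SC.AddFG) (hM : SC.MulFG) (hK : SC.AddKernelsFG)
    (hG : SG.FinitelyGenerated) {φ : G → C} (hφ : SG.IsHom SC φ) (hs : Function.Surjective φ) :
    ∃ R : Finset G, {x | φ x = SC.zero} = SG.idealGen ↑R := by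
  classical
  obtain ⟨A, hA⟩ := hA.eq_univ
  obtain ⟨M, hM⟩ := hM.eq_univ
  obtain ⟨Y, hY⟩ := hG.eq_univ
  obtain ⟨s, hsφ⟩ := hs.hasRightInverse
  let X : Finset G := Y ∪ (A.image s ∪ M.image s)
  have hYX : ∀ y ∈ Y, y ∈ X := fun y hy => Finset.mem_union_left _ hy
  have hAX : ∀ a ∈ A, s a ∈ X := fun a ha =>
    Finset.mem_union_right _ (Finset.mem_union_left _ (Finset.mem_image_of_mem s ha))
  have hMX : ∀ m ∈ M, s m ∈ X := fun m hm =>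
    Finset.mem_union_right _ (Finset.mem_union_right _ (Finset.mem_image_of_mem s hm))
  let := SG.addGroup
  let := SC.addGroup
  let ev : FreeAddGroup X →+ G := FreeAddGroup.lift Subtype.val
  let φ' : G →+ C := { toFun := φ, map_zero' := hφ.map_zero, map_add' := hφ.1 }
  have hev : ∀ x ∈ X, ∃ w, ev w = x := fun x hx => ⟨.of ⟨x, hx⟩, by simp [ev]⟩
  have hsurj : Function.Surjective (φ'.comp ev) := by
    intro c
    have h := hA (φ'.comp ev).range ⟨zero_mem _, fun _ ha _ hb => add_mem ha hb,
      fun _ ha => neg_mem ha⟩ fun a ha => by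
        obtain ⟨w, hw⟩ := hev (s a) (hAX a ha)
        exact ⟨w, (congrArg φ hw).trans (hsφ a)⟩
    exact (h ▸ Set.mem_univ c : c ∈ ((φ'.comp ev).range : Set C))
  have hfgX : AddGroup.FG (FreeAddGroup X) := inferInstance
  obtain ⟨R, hRfin, hR⟩ := hK (FreeAddGroup X) (φ'.comp ev) hsurj
  choose p hp using hsurj
  have hp : ∀ c, φ (ev (p c)) = c := hp
  let rel : G → G := fun g => SG.add g (SG.neg (ev (p (φ g))))
  have hrel : ∀ g, φ (rel g) = SC.zero := fun g => hφ.mem_ker_of_eq (hp (φ g)).symm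
  let P : Finset (G × G) := X ×ˢ X
  let Rel : Finset G := hRfin.toFinset.image ev ∪
    (P.image (fun q => rel (SG.lam q.1 q.2)) ∪ P.image (fun q => rel (SG.lam (SG.inv q.1) q.2)))
  refine ⟨Rel, ?_⟩
  set N := SG.idealGen (Rel : Set G) with hN
  have hNker : N ⊆ {x | φ x = SC.zero} := by
    refine idealGen_subset hφ.isIdeal_ker fun x hx => ?_
    simp only [Rel, Finset.coe_union, Finset.coe_image, Set.Finite.coe_toFinset, Set.mem_union,
      Set.mem_image] at hx
    rcases hx with ⟨w, hw, rfl⟩ | ⟨q, -, rfl⟩ | ⟨q, -, rfl⟩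
    · have : w ∈ (φ'.comp ev).ker := hR ▸ AddSubgroup.subset_normalClosure hw
      exact this
    · exact hrel _
    · exact hrel _
  refine Set.Subset.antisymm ?_ hNker
  obtain ⟨H, SH, π, hπ, -, hπN⟩ := (isIdeal_idealGen (S := SG) (Rel : Set G)).exists_quotient
  have hπ0 : ∀ x, π x = SH.zero ↔ x ∈ N := fun x => Set.ext_iff.mp hπN x
  have hπφ : ∀ a b, π a = π b → φ a = φ b := fun a b h => by
    have h1 := hNker ((hπ0 _).mp (hπ.mem_ker_of_eq h))
    rw [Set.mem_ofPred_eq, hφ.1, hφ.map_neg] at h1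
    exact SC.add_neg_eq_zero.mp h1
  let := SH.addGroup
  let π' : G →+ H := { toFun := π, map_zero' := hπ.map_zero, map_add' := hπ.1 }
  have hker : ∀ w, φ (ev w) = SC.zero → π (ev w) = SH.zero := by
    intro w hw
    have hw : w ∈ AddSubgroup.normalClosure R := by rw [hR]; exact hw
    have hle : AddSubgroup.normalClosure R ≤ (π'.comp ev).ker :=
      AddSubgroup.normalClosure_le_normal fun r hr => (hπ0 _).mpr <|
        subset_idealGen _ (by simp only [Rel, Finset.coe_union, Finset.coe_image,
          Set.Finite.coe_toFinset]; exact Or.inl ⟨r, hr, rfl⟩)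
    exact hle hw
  let T : Set G := {g | ∃ w, π (ev w) = π g}
  have hT : SG.IsAddSubgroup T := by
    refine ⟨⟨0, by rw [map_zero]; rfl⟩, ?_, ?_⟩
    · rintro a ⟨v, hv⟩ b ⟨w, hw⟩
      exact ⟨v + w, by rw [map_add, hπ.1, ← hv, ← hw]; exact hπ.1 _ _⟩
    · rintro a ⟨v, hv⟩
      exact ⟨-v, by rw [map_neg, hπ.map_neg, ← hv]; exact hπ.map_neg _⟩
  have hTsat : ∀ {a b}, π a = π b → a ∈ T → b ∈ T := fun h ⟨w, hw⟩ => ⟨w, hw.trans h⟩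
  have hevT : ∀ w, ev w ∈ T := fun w => ⟨w, rfl⟩
  have hXT : ∀ x ∈ X, x ∈ T := fun x hx => (hev x hx).elim fun w hw => hw ▸ hevT w
  have hrelT : ∀ g, rel g ∈ N → g ∈ T := by
    intro g hg
    have h := (hπ0 _).mpr hg
    rw [hπ.1, hπ.map_neg] at h
    exact ⟨p (φ g), (SH.add_neg_eq_zero.mp h).symm⟩
  have hlamT : ∀ v, (∀ x ∈ X, rel (SG.lam v x) ∈ N) → ∀ t ∈ T, SG.lam v t ∈ T := by
    rintro v hv t ⟨w, hw⟩
    have hsat : π (SG.lam v (ev w)) = π (SG.lam v t) := by rw [hπ.map_lam, hπ.map_lam, hw]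
    refine hTsat hsat ?_
    clear hsat hw
    induction w using FreeAddGroup.induction_on with
    | C1 => rw [map_zero]; exact (SG.lam_zero v).symm ▸ hT.1
    | of x => exact hrelT _ (by simpa [ev] using hv x x.2)
    | neg_of x ih => rw [map_neg]; exact (SG.lam_neg v _).symm ▸ hT.2.2 _ ih
    | add a b ha hb => rw [map_add]; exact (SG.lam_add v _ _).symm ▸ hT.2.1 _ ha _ hb
  let W : Set G := {v | v ∈ T ∧ (∀ t ∈ T, SG.lam v t ∈ T) ∧ ∀ t ∈ T, SG.lam (SG.inv v) t ∈ T}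
  have hW : SG.IsMulSubgroup W := hT.isMulSubgroup_stabilizer
  have hXW : ∀ x ∈ X, x ∈ W := by
    refine fun x hx => ⟨hXT x hx, hlamT _ fun y hy => ?_, hlamT _ fun y hy => ?_⟩ <;>
      refine subset_idealGen _ ?_ <;> simp only [Rel, Finset.coe_union, Finset.coe_image]
    · exact Or.inr (Or.inl ⟨(x, y), by simp [P, hx, hy], rfl⟩)
    · exact Or.inr (Or.inr ⟨(x, y), by simp [P, hx, hy], rfl⟩)
  have hWsurj : φ '' W = Set.univ := by
    refine hM _ ⟨⟨_, hW.1, hφ.map_zero⟩, ?_, ?_⟩ fun m hm =>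
      ⟨s m, hXW _ (hMX m hm), hsφ m⟩
    · rintro _ ⟨a, ha, rfl⟩ _ ⟨b, hb, rfl⟩
      exact ⟨_, hW.2.1 _ ha _ hb, hφ.2 _ _⟩
    · rintro _ ⟨a, ha, rfl⟩
      exact ⟨_, hW.2.2 _ ha, hφ.map_inv _⟩
  have hinj : ∀ t ∈ T, φ t = SC.zero → t ∈ N := by
    rintro t ⟨w, hw⟩ ht
    rw [← hπ0, ← hw]
    exact hker w ((hπφ _ _ hw).trans ht)
  have hTW : T ⊆ W := by
    intro t ht
    obtain ⟨v, hv, hvt⟩ : φ t ∈ φ '' W := hWsurj ▸ Set.mem_univ _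
    have h := (hπ0 _).mpr (hinj _ (hT.2.1 _ ht _ (hT.2.2 _ hv.1)) (hφ.mem_ker_of_eq hvt.symm))
    rw [hπ.1, hπ.map_neg] at h
    have h := SH.add_neg_eq_zero.mp h
    refine ⟨ht, fun u hu => hTsat ?_ (hv.2.1 u hu), fun u hu => hTsat ?_ (hv.2.2 u hu)⟩ <;>
      simp only [hπ.map_lam, hπ.map_inv, h]
  have hTuniv : T = Set.univ :=
    hY T ⟨hT.1, hT.2.1, hT.2.2, fun a ha b hb => (hW.2.1 a (hTW ha) b (hTW hb)).1,
      fun a ha => (hW.2.2 a (hTW ha)).1⟩ fun y hy => hXT y (hYX y hy)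
  exact fun g hg => hinj g (hTuniv ▸ Set.mem_univ g) hg

end KernelsOfFinitelyGeneratedBraces

section SocleExtensions

variable {B C : Type u} {S : SkewBrace B} {SC : SkewBrace C}

theorem subset_addClosure (X : Set B) : X ⊆ S.addClosure X := fun _ hx _ hT => hT.2 hx

theorem addClosure_subset {X T : Set B} (hT : S.IsAddSubgroup T) (h : X ⊆ T) :
    S.addClosure X ⊆ T :=
  fun _ hx => hx T ⟨hT, h⟩

theorem isAddSubgroup_addClosure (X : Set B) : S.IsAddSubgroup (S.addClosure X) :=
  ⟨fun _ hT => hT.1.1, fun _ ha _ hb T hT => hT.1.2.1 _ (ha T hT) _ (hb T hT),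
    fun _ ha T hT => hT.1.2.2 _ (ha T hT)⟩

theorem IsAddSubgroup.preimage_lam {T : Set B} (hT : S.IsAddSubgroup T) (b : B) :
    S.IsAddSubgroup (S.lam b ⁻¹' T) := by
  refine ⟨?_, fun x hx y hy => ?_, fun x hx => ?_⟩
  · rw [Set.mem_preimage, lam_zero]
    exact hT.1
  · rw [Set.mem_preimage, lam_add]
    exact hT.2.1 _ hx _ hy
  · rw [Set.mem_preimage, lam_neg]
    exact hT.2.2 _ hx

theorem isIdeal_addClosure_of_subset_soc {X : Set B} (hX : X ⊆ S.soc)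
    (hlam : ∀ b, ∀ x ∈ X, S.lam b x ∈ X) : S.IsIdeal (S.addClosure X) := by
  have hsoc : S.addClosure X ⊆ S.soc := addClosure_subset isIdeal_soc.1 hX
  have hl : ∀ b, ∀ a ∈ S.addClosure X, S.lam b a ∈ S.addClosure X := fun b =>
    addClosure_subset ((isAddSubgroup_addClosure X).preimage_lam b)
      fun x hx => subset_addClosure X (hlam b x hx)
  refine ⟨isAddSubgroup_addClosure X, fun b a ha => ?_, fun b a ha => ?_, hl⟩
  · rw [← (hsoc ha).2, S.add_assoc, S.add_neg, S.add_zero]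
    exact ha
  · rw [conj_eq_lam_of_mem_soc (hsoc ha)]
    exact hl b a ha

theorem IsMulSubgroup.isAddSubgroup_inter_soc {T : Set B} (hT : S.IsMulSubgroup T) :
    S.IsAddSubgroup (T ∩ S.soc) := by
  have h := (isIdeal_soc (S := S)).1
  refine ⟨⟨hT.1, h.1⟩, fun a ha b hb => ⟨?_, h.2.1 a ha.2 b hb.2⟩, fun a ha => ⟨?_, h.2.2 a ha.2⟩⟩
  · rw [add_eq_mul_of_mem_soc ha.2]
    exact hT.2.1 a ha.1 b hb.1
  · rw [neg_eq_inv_of_mem_soc ha.2]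
    exact hT.2.2 a ha.1

/-- Finite generation of `(C,+)` and `(C,∘)` together with finitely normally generated kernels for
`(C,+)` lift along a surjection `B → C` with kernel in the socle, if `B` is finitely generated and
has finite `∘`-conjugacy classes. -/
theorem addFG_mulFG_addKernelsFG_of_ker_subset_soc {g : B → C} (hg : S.IsHom SC g)
    (hs : Function.Surjective g) (hker : {x | g x = SC.zero} ⊆ S.soc) (hS : S.FinitelyGenerated)
    (hFC : ∀ x, (Set.range fun b => S.mul (S.mul b x) (S.inv b)).Finite)
    (hC : SC.AddFG ∧ SC.MulFG ∧ SC.AddKernelsFG) : S.AddFG ∧ S.MulFG ∧ S.AddKernelsFG := by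
  classical
  obtain ⟨hA, hM, hK⟩ := hC
  obtain ⟨R, hR⟩ := exists_finset_ker_eq_idealGen hA hM hK hS hg hs
  obtain ⟨A, hA⟩ := hA.eq_univ
  obtain ⟨M, hM⟩ := hM.eq_univ
  obtain ⟨s, hsg⟩ := hs.hasRightInverse
  have hRsoc : ∀ r ∈ R, r ∈ S.soc := fun r hr => hker (hR ▸ subset_idealGen _ hr)
  have hfin : (⋃ r ∈ R, Set.range fun b => S.lam b r).Finite :=
    R.finite_toSet.biUnion fun r hr => by
      simpa only [conj_eq_lam_of_mem_soc (hRsoc r hr)] using hFC r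
  set X : Set B := ⋃ r ∈ R, Set.range fun b => S.lam b r with hX
  have hXmem : ∀ {x}, x ∈ X ↔ ∃ r ∈ R, ∃ b, S.lam b r = x := by simp [hX]
  have hXsoc : X ⊆ S.soc := fun x hx => by
    obtain ⟨r, hr, b, rfl⟩ := hXmem.mp hx
    exact isIdeal_soc.2.2.2 b r (hRsoc r hr)
  have hXlam : ∀ b, ∀ x ∈ X, S.lam b x ∈ X := fun b x hx => by
    obtain ⟨r, hr, c, rfl⟩ := hXmem.mp hx
    exact hXmem.mpr ⟨r, hr, S.mul b c, S.mul_lam b c r⟩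
  have hkerX : {x | g x = SC.zero} ⊆ S.addClosure X := by
    rw [hR]
    refine idealGen_subset (isIdeal_addClosure_of_subset_soc hXsoc hXlam) fun r hr => ?_
    exact subset_addClosure X (hXmem.mpr ⟨r, hr, S.zero, S.zero_lam r⟩)
  refine ⟨⟨hfin.toFinset ∪ A.image s, ?_⟩, ⟨hfin.toFinset ∪ M.image s, ?_⟩, ?_⟩
  · refine Set.eq_univ_of_forall fun b T ⟨hT, hXT⟩ => ?_
    simp only [Finset.coe_union, Finset.coe_image, Set.Finite.coe_toFinset,
      Set.union_subset_iff] at hXT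
    have h : g '' T = Set.univ := by
      refine hA _ ⟨⟨_, hT.1, hg.map_zero⟩, ?_, ?_⟩ fun a ha => ⟨s a, hXT.2 ⟨a, ha, rfl⟩, hsg a⟩
      · rintro _ ⟨a, ha, rfl⟩ _ ⟨b, hb, rfl⟩
        exact ⟨_, hT.2.1 _ ha _ hb, hg.1 _ _⟩
      · rintro _ ⟨a, ha, rfl⟩
        exact ⟨_, hT.2.2 _ ha, hg.map_neg _⟩
    obtain ⟨t, ht, htb⟩ : g b ∈ g '' T := h ▸ Set.mem_univ _
    have hk := addClosure_subset hT hXT.1 (hkerX (hg.mem_ker_of_eq htb.symm))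
    have := hT.2.1 _ hk _ ht
    rwa [S.add_assoc, S.neg_add, S.add_zero] at this
  · refine Set.eq_univ_of_forall fun b T ⟨hT, hXT⟩ => ?_
    simp only [Finset.coe_union, Finset.coe_image, Set.Finite.coe_toFinset,
      Set.union_subset_iff] at hXT
    have h : g '' T = Set.univ := by
      refine hM _ ⟨⟨_, hT.1, hg.map_zero⟩, ?_, ?_⟩ fun a ha => ⟨s a, hXT.2 ⟨a, ha, rfl⟩, hsg a⟩
      · rintro _ ⟨a, ha, rfl⟩ _ ⟨b, hb, rfl⟩
        exact ⟨_, hT.2.1 _ ha _ hb, hg.2 _ _⟩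
      · rintro _ ⟨a, ha, rfl⟩
        exact ⟨_, hT.2.2 _ ha, hg.map_inv _⟩
    obtain ⟨t, ht, htb⟩ : g b ∈ g '' T := h ▸ Set.mem_univ _
    have hmem : g (S.mul b (S.inv t)) = SC.zero := by
      rw [hg.2, hg.map_inv, htb, SC.mul_inv]
    have hk := addClosure_subset hT.isAddSubgroup_inter_soc
      (Set.subset_inter hXT.1 hXsoc) (hkerX hmem)
    have := hT.2.1 _ hk.1 _ ht
    rwa [S.mul_assoc, S.inv_mul, S.mul_zero] at this
  · let := S.addGroup
    let := SC.addGroup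
    let g' : B →+ C := { toFun := g, map_zero' := hg.map_zero, map_add' := hg.1 }
    exact AddGroup.KernelsFinitelyNormallyGenerated.of_central_extension hK g' hs fun x hx =>
      AddSubgroup.mem_center_iff.mpr fun b => ((hker hx).2 b).symm

end SocleExtensions

section SocleSeries

variable {B Q : Type u} {S : SkewBrace B} {SQ : SkewBrace Q} {I : Set B} {π : B → Q}

theorem IsQuotientBy.mem_iff (h : S.IsQuotientBy I SQ π) {x : B} : π x = SQ.zero ↔ x ∈ I :=
  Set.ext_iff.mp h.2.2 x

theorem IsQuotientBy.add_neg_mem_iff (h : S.IsQuotientBy I SQ π) {x y : B} :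
    S.add x (S.neg y) ∈ I ↔ π x = π y := by
  rw [← h.mem_iff, h.1.1, h.1.map_neg, SQ.add_neg_eq_zero]

theorem IsQuotientBy.socStep_eq (h : S.IsQuotientBy I SQ π) : S.socStep I = π ⁻¹' SQ.soc := by
  ext x
  simp only [socStep, soc, Set.mem_preimage, Set.mem_ofPred_eq, h.add_neg_mem_iff, h.1.map_lam,
    h.1.1, h.2.1.forall]

theorem IsIdeal.socStep (hI : S.IsIdeal I) : S.IsIdeal (S.socStep I) := by
  obtain ⟨Q, SQ, π, h⟩ := hI.exists_quotient
  rw [h.socStep_eq]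
  exact h.1.isIdeal_preimage isIdeal_soc

theorem IsIdeal.subset_socStep (hI : S.IsIdeal I) : I ⊆ S.socStep I := by
  obtain ⟨Q, SQ, π, h⟩ := hI.exists_quotient
  rw [h.socStep_eq]
  intro x hx
  rw [Set.mem_preimage, h.mem_iff.mpr hx]
  exact isIdeal_soc.1.1

theorem isIdeal_iUnion_of_directed {ι : Type*} [Nonempty ι] {I : ι → Set B}
    (hI : ∀ i, S.IsIdeal (I i)) (hd : Directed (· ⊆ ·) I) : S.IsIdeal (⋃ i, I i) := by
  simp only [IsIdeal, IsAddSubgroup, Set.mem_iUnion, forall_exists_index]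
  refine ⟨⟨⟨Classical.arbitrary ι, (hI _).1.1⟩, fun a i ha b j hb => ?_,
    fun a i ha => ⟨i, (hI i).1.2.2 a ha⟩⟩, fun b a i ha => ⟨i, (hI i).2.1 b a ha⟩,
    fun b a i ha => ⟨i, (hI i).2.2.1 b a ha⟩, fun b a i ha => ⟨i, (hI i).2.2.2 b a ha⟩⟩
  obtain ⟨k, hik, hjk⟩ := hd i j
  exact ⟨k, (hI k).1.2.1 a (hik ha) b (hjk hb)⟩

variable (S)

theorem socSeries_zero : S.socSeries (0 : Ordinal.{v}) = {S.zero} := by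
  simp [socSeries]

theorem socSeries_add_one (o : Ordinal.{v}) :
    S.socSeries (o + 1) = S.socStep (S.socSeries o) := by
  simp [socSeries]

theorem socSeries_limit {o : Ordinal.{v}} (ho : Order.IsSuccLimit o) :
    S.socSeries o = ⋃ β : Set.Iio o, S.socSeries β.1 := by
  rw [Set.iUnion_subtype, socSeries, Ordinal.limitRecOn_limit _ _ _ _ ho]
  rfl

theorem isIdeal_socSeries_and_subset (o : Ordinal.{v}) :
    S.IsIdeal (S.socSeries o) ∧ ∀ β ≤ o, S.socSeries β ⊆ S.socSeries o := by
  induction o using Ordinal.limitRecOn with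
  | zero =>
    rw [socSeries_zero]
    refine ⟨isIdeal_zero, fun β hβ => ?_⟩
    rw [nonpos_iff_eq_zero.mp hβ, socSeries_zero]
  | add_one o ih =>
    rw [socSeries_add_one]
    refine ⟨ih.1.socStep, fun β hβ => ?_⟩
    rcases hβ.eq_or_lt with rfl | hβ
    · rw [socSeries_add_one]
    · exact (ih.2 β (Order.lt_add_one_iff.mp hβ)).trans ih.1.subset_socStep
  | limit o ho ih =>
    have : Nonempty (Set.Iio o) := ⟨⟨0, ho.bot_lt⟩⟩
    have hmono : Monotone fun β : Set.Iio o => S.socSeries β.1 :=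
      fun β γ h => (ih γ.1 γ.2).2 β.1 h
    refine ⟨?_, fun β hβ => ?_⟩
    · rw [socSeries_limit S ho]
      exact isIdeal_iUnion_of_directed (fun β => (ih β.1 β.2).1) hmono.directed_le
    · rcases hβ.eq_or_lt with rfl | hβ
      · rfl
      · rw [socSeries_limit S ho]
        exact Set.subset_iUnion (fun β : Set.Iio o => S.socSeries β.1) ⟨β, hβ⟩

theorem isIdeal_socSeries (o : Ordinal.{v}) : S.IsIdeal (S.socSeries o) :=
  (S.isIdeal_socSeries_and_subset o).1

theorem socSeries_mono : Monotone fun o : Ordinal.{v} => S.socSeries o :=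
  fun β o h => (S.isIdeal_socSeries_and_subset o).2 β h

end SocleSeries

section Main

variable {B C Q : Type u} {S : SkewBrace B} {SC : SkewBrace C} {SQ : SkewBrace Q}

/-- A trivial skew brace has finitely generated groups and finitely normally generated kernels. -/
theorem addFG_mulFG_addKernelsFG_of_subsingleton [Subsingleton B] :
    S.AddFG ∧ S.MulFG ∧ S.AddKernelsFG := by
  refine ⟨⟨∅, ?_⟩, ⟨∅, ?_⟩, ?_⟩
  · exact Set.eq_univ_of_forall fun b T hT => Subsingleton.elim S.zero b ▸ hT.1.1
  · exact Set.eq_univ_of_forall fun b T hT => Subsingleton.elim S.zero b ▸ hT.1.1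
  · let := S.addGroup
    intro Γ _ _ f _
    have h : f.ker = ⊤ := top_unique fun x _ => Subsingleton.elim (α := B) _ _
    obtain ⟨X, hX, hfin⟩ := AddGroup.fg_iff.mp ‹AddGroup.FG Γ›
    refine ⟨X, hfin, ?_⟩
    rw [h, ← top_le_iff, ← hX]
    exact AddSubgroup.closure_le_normalClosure

/-- A surjection whose kernel is contained in that of another one factors it. -/
theorem IsHom.exists_factor {g : B → C} {π : B → Q} (hπ : S.IsHom SQ π)
    (hs : Function.Surjective π) (hg : S.IsHom SC g) (h : ∀ x, π x = SQ.zero → g x = SC.zero) :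
    ∃ k : Q → C, SQ.IsHom SC k ∧ ∀ x, k (π x) = g x := by
  obtain ⟨s, hsπ⟩ := hs.hasRightInverse
  have hk : ∀ x, g (s (π x)) = g x := fun x => by
    have h1 := h _ (hπ.mem_ker_of_eq (hsπ (π x)))
    rw [hg.1, hg.map_neg] at h1
    exact SC.add_neg_eq_zero.mp h1
  refine ⟨g ∘ s, ⟨?_, ?_⟩, hk⟩ <;> refine hs.forall₂.mpr fun a b => ?_
  · rw [← hπ.1]
    simp only [Function.comp_apply, hk, hg.1]
  · rw [← hπ.2]
    simp only [Function.comp_apply, hk, hg.2]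

theorem IsHom.finite_conj {π : B → Q} (hπ : S.IsHom SQ π) (hs : Function.Surjective π)
    (hFC : ∀ x, (Set.range fun b => S.mul (S.mul b x) (S.inv b)).Finite) (y : Q) :
    (Set.range fun b => SQ.mul (SQ.mul b y) (SQ.inv b)).Finite := by
  obtain ⟨x, rfl⟩ := hs y
  refine ((hFC x).image π).subset ?_
  rintro _ ⟨b, rfl⟩
  obtain ⟨b, rfl⟩ := hs b
  exact ⟨_, ⟨b, rfl⟩, by simp only [hπ.2, hπ.map_inv]⟩

end Main

end SkewBrace

open SkewBrace

/-- **Theorem.** Let `B` be a socle hypercentral skew brace (`B = Soc_λ(B)` for some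
ordinal `λ`) in which every element of the group `(B,∘)` has only finitely many
conjugates in `(B,∘)`. If `B` is finitely generated as a skew brace, then `B` is
finitely presented as a skew brace. -/
theorem finitely_presented_of_socle_hypercentral {B : Type u} (S : SkewBrace B)
    (hsoc : ∃ o : Ordinal.{u}, S.socSeries o = Set.univ)
    (hFC : ∀ x : B, (Set.range fun g => S.mul (S.mul g x) (S.inv g)).Finite)
    (hfg : S.FinitelyGenerated) :
    S.FinitelyPresented := by
  let P : Ordinal.{u} → Prop := fun o => ∃ (C : Type u) (SC : SkewBrace C) (π : B → C),
    S.IsQuotientBy (S.socSeries o) SC π ∧ SC.AddFG ∧ SC.MulFG ∧ SC.AddKernelsFG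
  have hP : ∃ o, P o := by
    obtain ⟨o, ho⟩ := hsoc
    obtain ⟨C, SC, π, h⟩ := (S.isIdeal_socSeries o).exists_quotient
    have hzero : ∀ c, c = SC.zero := h.2.1.forall.mpr fun x => h.mem_iff.mpr (ho ▸ Set.mem_univ x)
    have : Subsingleton C := ⟨fun a b => (hzero a).trans (hzero b).symm⟩
    exact ⟨o, C, SC, π, h, addFG_mulFG_addKernelsFG_of_subsingleton⟩
  obtain ⟨o, ⟨C, SC, π, h, hC⟩, hmin⟩ := wellFounded_lt.has_min {o | P o} hP
  rcases Ordinal.zero_or_succ_or_isSuccLimit o with rfl | ⟨β, rfl⟩ | ho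
  · obtain ⟨m, θ, hθ, hθs⟩ := hfg.exists_free_surjective
    refine ⟨_, free (Fin m), m, freeOf, θ, isFreeOn_free _, hθ, hθs, ?_⟩
    have hπθ : IsHom (free (Fin m)) SC (π ∘ θ) :=
      ⟨fun a b => by simp only [Function.comp_apply, hθ.1, h.1.1],
        fun a b => by simp only [Function.comp_apply, hθ.2, h.1.2]⟩
    obtain ⟨R, hR⟩ := exists_finset_ker_eq_idealGen hC.1 hC.2.1 hC.2.2
      (finitelyGenerated_free (Fin m)) hπθ (h.2.1.comp hθs)
    refine ⟨R, Eq.trans (Set.ext fun x => ?_) hR⟩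
    have := h.mem_iff (x := θ x)
    rw [socSeries_zero] at this
    exact this.symm
  · obtain ⟨D, SD, ρ, hρ⟩ := (S.isIdeal_socSeries β).exists_quotient
    rw [Order.succ_eq_add_one, socSeries_add_one] at h
    obtain ⟨g, hg, hgρ⟩ := hρ.1.exists_factor hρ.2.1 h.1 fun x hx =>
      h.mem_iff.mpr ((S.isIdeal_socSeries β).subset_socStep (hρ.mem_iff.mp hx))
    have hker : {y | g y = SC.zero} ⊆ SD.soc := hρ.2.1.forall.mpr fun x hx => by
      have hx : g (ρ x) = SC.zero := hx
      rw [hgρ, h.mem_iff, hρ.socStep_eq] at hx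
      exact hx
    have hgs : Function.Surjective g := fun c => (h.2.1 c).imp' ρ fun x hx => (hgρ x).trans hx
    exact (hmin β ⟨D, SD, ρ, hρ, addFG_mulFG_addKernelsFG_of_ker_subset_soc hg hgs hker
      (hρ.1.finitelyGenerated hρ.2.1 hfg) (hρ.1.finite_conj hρ.2.1 hFC) hC⟩
      (Order.lt_add_one_iff.mpr le_rfl)).elim
  · obtain ⟨R, hR⟩ := exists_finset_ker_eq_idealGen hC.1 hC.2.1 hC.2.2 hfg h.1 h.2.1
    rw [h.2.2] at hR
    have : Nonempty (Set.Iio o) := ⟨⟨0, ho.bot_lt⟩⟩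
    have hmono : Monotone fun β : Set.Iio o => S.socSeries β.1 :=
      fun β γ hβγ => S.socSeries_mono hβγ
    obtain ⟨β, hβ⟩ := hmono.directed_le.exists_mem_subset_of_finset_subset_biUnion (s := R)
      (by rw [← socSeries_limit S ho, hR]; exact subset_idealGen _)
    have heq : S.socSeries o = S.socSeries β.1 :=
      (hR.trans_subset (idealGen_subset (S.isIdeal_socSeries β.1) hβ)).antisymm
        (S.socSeries_mono β.2.le)
    exact (hmin β.1 ⟨C, SC, π, heq ▸ h, hC⟩ β.2).elim
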